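/- Let f : Γⁿ → ℝ be a smooth symmetric function on the open positive cone with ∂_i f > 0 everywhere, and let F(A) = f(λ₁,…,λ_n) be the induced O(n)-invariant function on positive-definite symmetric matrices, where λᵢ are the eigenvalues of A. Then for every A ∈ Γ, the matrix B representing DF_A via DF_A(M) = Tr(BM) is positive definite. -/

import Mathlib

open Matrix

lemma quad_eq_sum {n : ℕ} {A : Matrix (Fin n) (Fin n) ℝ} (hA : A.IsHermitian)
    (x : EuclideanSpace ℝ (Fin n)) :
    x.ofLp ⬝ᵥ (A *ᵥ x.ofLp)
      = ∑ j, hA.eigenvalues j * (inner ℝ (hA.eigenvectorBasis j) x) ^ 2 := by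
  have h1 : x.ofLp ⬝ᵥ (A *ᵥ x.ofLp) = inner ℝ x (WithLp.toLp 2 (A *ᵥ x.ofLp)) := by
    rw [EuclideanSpace.inner_eq_star_dotProduct, dotProduct_comm]
    simp
  rw [h1, ← hA.eigenvectorBasis.sum_inner_mul_inner]
  refine Finset.sum_congr rfl fun j _ => ?_
  have h2 : inner ℝ (hA.eigenvectorBasis j) (WithLp.toLp 2 (A *ᵥ x.ofLp))
      = hA.eigenvalues j * inner ℝ (hA.eigenvectorBasis j) x := by
    have hT : Aᵀ = A := by rw [← conjTranspose_eq_transpose_of_trivial]; exact hA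
    rw [EuclideanSpace.inner_eq_star_dotProduct, EuclideanSpace.inner_eq_star_dotProduct]
    simp only [star_trivial]
    rw [dotProduct_comm, dotProduct_mulVec, ← mulVec_transpose, hT, hA.mulVec_eigenvectorBasis,
      smul_dotProduct, dotProduct_comm, smul_eq_mul]
  rw [h2, real_inner_comm]
  ring

lemma norm_eq_sum {n : ℕ} {A : Matrix (Fin n) (Fin n) ℝ} (hA : A.IsHermitian)
    (x : EuclideanSpace ℝ (Fin n)) :
    ‖x‖ ^ 2 = ∑ j, (inner ℝ (hA.eigenvectorBasis j) x) ^ 2 := by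
  rw [← real_inner_self_eq_norm_sq, ← hA.eigenvectorBasis.sum_inner_mul_inner]
  refine Finset.sum_congr rfl fun j _ => ?_
  rw [real_inner_comm]
  ring

/-- Weyl monotonicity of the ordered eigenvalues. -/
lemma eigenvalues_mono {n : ℕ} {A A' : Matrix (Fin n) (Fin n) ℝ} (hA : A.IsHermitian)
    (hA' : A'.IsHermitian) (h : ∀ x : Fin n → ℝ, x ⬝ᵥ (A *ᵥ x) ≤ x ⬝ᵥ (A' *ᵥ x)) (i : Fin n) :
    hA.eigenvalues i ≤ hA'.eigenvalues i := by
  let e : Fin n → Fin (Fintype.card (Fin n)) :=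
    (Fintype.equivOfCardEq (Fintype.card_fin _) : Fin (Fintype.card (Fin n)) ≃ Fin n).symm
  have he : Function.Injective e := Equiv.injective _
  have hanti : ∀ {C : Matrix (Fin n) (Fin n) ℝ} (hC : C.IsHermitian) (j k : Fin n),
      e j ≤ e k → hC.eigenvalues k ≤ hC.eigenvalues j := fun hC j k hjk =>
    hC.eigenvalues₀_antitone hjk
  let φ : EuclideanSpace ℝ (Fin n) →ₗ[ℝ] ({j : Fin n // j ≠ i} → ℝ) :=
    LinearMap.pi fun j => (innerSL ℝ (if e i < e j then hA.eigenvectorBasis j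
      else hA'.eigenvectorBasis j)).toLinearMap
  have hker : LinearMap.ker φ ≠ ⊥ := by
    apply LinearMap.ker_ne_bot_of_finrank_lt
    have : 0 < n := i.pos
    simp
    omega
  obtain ⟨x, hx, hx0⟩ := (Submodule.ne_bot_iff _).1 hker
  have hφ : ∀ j : Fin n, j ≠ i → inner ℝ (if e i < e j then hA.eigenvectorBasis j
      else hA'.eigenvectorBasis j) x = 0 := fun j hj => by
    have := congrFun (LinearMap.mem_ker.1 hx) ⟨j, hj⟩
    simpa [φ] using this
  have h1 : hA.eigenvalues i * ‖x‖ ^ 2 ≤ x.ofLp ⬝ᵥ (A *ᵥ x.ofLp) := by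
    rw [quad_eq_sum hA, norm_eq_sum hA, Finset.mul_sum]
    refine Finset.sum_le_sum fun j _ => ?_
    by_cases hj : e i < e j
    · have := hφ j (by rintro rfl; exact lt_irrefl _ hj)
      rw [if_pos hj] at this
      simp [this]
    · exact mul_le_mul_of_nonneg_right (hanti hA _ _ (not_lt.1 hj)) (sq_nonneg _)
  have h2 : x.ofLp ⬝ᵥ (A' *ᵥ x.ofLp) ≤ hA'.eigenvalues i * ‖x‖ ^ 2 := by
    rw [quad_eq_sum hA', norm_eq_sum hA', Finset.mul_sum]
    refine Finset.sum_le_sum fun j _ => ?_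
    by_cases hj : e j < e i
    · have := hφ j (by rintro rfl; exact lt_irrefl _ hj)
      rw [if_neg (not_lt.2 hj.le)] at this
      simp [this]
    · exact mul_le_mul_of_nonneg_right (hanti hA' _ _ (not_lt.1 hj)) (sq_nonneg _)
  have h3 : 0 < ‖x‖ ^ 2 := by have := norm_pos_iff.2 hx0; positivity
  exact le_of_mul_le_mul_right ((h1.trans (h _)).trans h2) h3

/-- Increments of `f` in nonnegative directions are bounded below. -/
lemma increment_lower_bound {n : ℕ} (hn : 0 < n) {f : (Fin n → ℝ) → ℝ} {x : Fin n → ℝ}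
    (hf : DifferentiableAt ℝ f x) (hpos : ∀ i, 0 < fderiv ℝ f x (Pi.single i 1)) :
    ∃ c > 0, ∃ δ > 0, ∀ y : Fin n → ℝ, (∀ i, x i ≤ y i) → (∑ i, (y i - x i)) < δ →
      c * ∑ i, (y i - x i) ≤ f y - f x := by
  have : Nonempty (Fin n) := ⟨⟨0, hn⟩⟩
  obtain ⟨i₀, hi₀⟩ := Finite.exists_min fun i => fderiv ℝ f x (Pi.single i 1)
  set c := fderiv ℝ f x (Pi.single i₀ 1) with hc
  have hc0 : 0 < c := hpos i₀
  have ho := (hasFDerivAt_iff_isLittleO.1 hf.hasFDerivAt).def (half_pos hc0)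
  obtain ⟨δ, hδ, hball⟩ := Metric.eventually_nhds_iff.1 ho
  refine ⟨c / 2, half_pos hc0, δ, hδ, fun y hy hlt => ?_⟩
  have hnn : ∀ i, 0 ≤ y i - x i := fun i => sub_nonneg.2 (hy i)
  have hnorm : ‖y - x‖ ≤ ∑ i, (y i - x i) := by
    refine (pi_norm_le_iff_of_nonneg (Finset.sum_nonneg fun i _ => hnn i)).2 fun i => ?_
    rw [Pi.sub_apply, Real.norm_of_nonneg (hnn i)]
    exact Finset.single_le_sum (f := fun i => y i - x i) (fun i _ => hnn i) (Finset.mem_univ i)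
  have hb := hball (y := y) (by rw [dist_eq_norm]; exact hnorm.trans_lt hlt)
  have hL : c * ∑ i, (y i - x i) ≤ fderiv ℝ f x (y - x) := by
    have h1 : fderiv ℝ f x (y - x) = ∑ i, (y i - x i) * fderiv ℝ f x (Pi.single i 1) := by
      conv_lhs => rw [pi_eq_sum_univ' (y - x)]
      rw [map_sum]
      refine Finset.sum_congr rfl fun i _ => ?_
      rw [map_smul, smul_eq_mul, Pi.sub_apply]
    rw [h1, Finset.mul_sum]
    refine Finset.sum_le_sum fun i _ => ?_
    rw [mul_comm]
    exact mul_le_mul_of_nonneg_left (hi₀ i) (hnn i)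
  rw [Real.norm_eq_abs] at hb
  have h2 := (abs_le.1 hb).1
  have h3 := mul_le_mul_of_nonneg_left hnorm (half_pos hc0).le
  linarith

/-- If `F` is the `O(n)`-invariant function on positive-definite symmetric matrices induced
by a smooth symmetric strictly elliptic function `f` on the open positive cone (via the
eigenvalues), then for every positive-definite `A`, the symmetric matrix `B` representing
`DF_A` via `DF_A(M) = Tr(BM)` is positive definite. -/
theorem representing_matrix_posDef (n : ℕ) (f : (Fin n → ℝ) → ℝ)
    (hsmooth : ContDiffOn ℝ (⊤ : ℕ∞) f {x : Fin n → ℝ | ∀ i, 0 < x i})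
    (hsym : ∀ σ : Equiv.Perm (Fin n), ∀ x : Fin n → ℝ, (∀ i, 0 < x i) →
      f (x ∘ σ) = f x)
    (hell : ∀ x : Fin n → ℝ, (∀ i, 0 < x i) → ∀ i : Fin n,
      0 < fderiv ℝ f x (Pi.single i 1))
    (F : Matrix (Fin n) (Fin n) ℝ → ℝ)
    (hF : ∀ (A : Matrix (Fin n) (Fin n) ℝ) (hA : A.IsHermitian), A.PosDef →
      F A = f hA.eigenvalues)
    (A B : Matrix (Fin n) (Fin n) ℝ) (hA : A.PosDef) (hBs : B.IsSymm)
    (hB : ∀ M : Matrix (Fin n) (Fin n) ℝ, M.IsSymm →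
      HasDerivAt (fun s : ℝ => F (A + s • M)) ((B * M).trace) 0) :
    B.PosDef := by
  refine PosDef.of_dotProduct_mulVec_pos (by rw [IsHermitian, conjTranspose_eq_transpose_of_trivial]; exact hBs)
    fun v hv => ?_
  rw [star_trivial]
  have hn : 0 < n := by
    rcases Nat.eq_zero_or_pos n with rfl | h
    · exact absurd (Subsingleton.elim v 0) hv
    · exact h
  set M := vecMulVec v v with hM
  have hMs : M.IsSymm := by
    ext i j; simp [hM, vecMulVec_apply, mul_comm]
  have hMp : M.PosSemidef := by simpa using posSemidef_vecMulVec_self_star v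
  have htr : (B * M).trace = v ⬝ᵥ (B *ᵥ v) := by
    rw [hM, mul_vecMulVec, trace_vecMulVec, dotProduct_comm]
  have hvv : 0 < v ⬝ᵥ v := by
    simpa using (dotProduct_star_self_pos_iff (v := v)).2 hv
  have hd := hB M hMs
  rw [htr] at hd
  have hopen : IsOpen {x : Fin n → ℝ | ∀ i, 0 < x i} := by
    simp only [Set.ofPred_forall]
    exact isOpen_iInter_of_finite fun i => isOpen_lt continuous_const (continuous_apply i)
  have hev := fun i => hA.eigenvalues_pos i
  have hdiff : DifferentiableAt ℝ f hA.1.eigenvalues :=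
    (hsmooth.contDiffAt (hopen.mem_nhds hev)).differentiableAt (by simp)
  obtain ⟨c, hc, δ, hδ, hinc⟩ := increment_lower_bound hn hdiff (hell _ hev)
  have hslope := (hasDerivAt_iff_tendsto_slope.1 hd).mono_left
    (nhdsWithin_mono 0 (fun s (hs : 0 < s) => hs.ne') : nhdsWithin (0:ℝ) (Set.Ioi 0) ≤ _)
  refine lt_of_lt_of_le (mul_pos hc hvv) (ge_of_tendsto hslope ?_)
  have hsmall : ∀ᶠ s in nhdsWithin (0:ℝ) (Set.Ioi 0), s < δ / (v ⬝ᵥ v) :=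
    nhdsWithin_le_nhds (Iio_mem_nhds (div_pos hδ hvv))
  filter_upwards [self_mem_nhdsWithin, hsmall] with s hs hsδ
  have hs : 0 < s := hs
  have hA' : (A + s • M).PosDef := hA.add_posSemidef (hMp.smul hs.le)
  have hmono := eigenvalues_mono hA.1 hA'.1 (fun x => by
    rw [add_mulVec, dotProduct_add]
    have := (hMp.smul hs.le).dotProduct_mulVec_nonneg x
    simp only [star_trivial] at this
    linarith)
  have hsum : ∑ i, (hA'.1.eigenvalues i - hA.1.eigenvalues i) = s * (v ⬝ᵥ v) := by
    have h1 := hA.1.trace_eq_sum_eigenvalues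
    have h2 := hA'.1.trace_eq_sum_eigenvalues
    simp only [RCLike.ofReal_real_eq_id, id] at h1 h2
    rw [Finset.sum_sub_distrib, ← h1, ← h2, trace_add, trace_smul, hM, trace_vecMulVec,
      smul_eq_mul]
    ring
  have hfin := hinc _ hmono (by rw [hsum]; exact (lt_div_iff₀ hvv).1 hsδ)
  rw [hsum] at hfin
  rw [slope_def_field, sub_zero, zero_smul, add_zero, hF _ hA'.1 hA', hF _ hA.1 hA,
    le_div_iff₀ hs]
  linarith
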